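/- arXiv:2508.12228 — 2 statements merged into one kernel-verified Lean document; each statement's English description precedes it below -/
import Mathlib

section
/- Let d ≥ 1, α > 0 and f : ℝ^d → ℝ, and let f_α be the uniform-ball smoothed function. Then: (1) if f is L_0-Lipschitz, then f_α is L_0-Lipschitz; (2) if f is L-smooth, then f_α is differentiable and L-smooth; (3) if f is μ-strongly convex and differentiable, then f_α is μ-strongly convex. -/
open MeasureTheory ProbabilityTheory
open scoped RealInnerProductSpace

noncomputable section

abbrev Euc (d : ℕ) : Type := EuclideanSpace ℝ (Fin d)

/-- Uniform probability distribution on the closed unit ball of `ℝ^d`. -/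
def unifBall (d : ℕ) : Measure (Euc d) :=
  (volume (Metric.closedBall (0 : Euc d) 1))⁻¹ •
    volume.restrict (Metric.closedBall (0 : Euc d) 1)

/-- Uniform (rotation-invariant) probability distribution on the unit sphere of `ℝ^d`,
realized as the pushforward of the uniform ball distribution under normalization. -/
def unifSphere (d : ℕ) : Measure (Euc d) :=
  Measure.map (fun x => ‖x‖⁻¹ • x) (unifBall d)

/-- Uniform-ball smoothed function `f_α(x) = E[f(x + α·ũ)]`, `ũ` uniform on the closed unit ball. -/
def smoothed (d : ℕ) (f : Euc d → ℝ) (α : ℝ) (x : Euc d) : ℝ :=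
  ∫ u, f (x + α • u) ∂(unifBall d)

instance isProbabilityMeasure_unifBall (d : ℕ) : IsProbabilityMeasure (unifBall d) :=
  cond_isProbabilityMeasure_of_finite
    (Metric.measure_closedBall_pos volume 0 one_pos).ne' measure_closedBall_lt_top.ne

theorem ae_unifBall_norm_le_one (d : ℕ) : ∀ᵐ u ∂(unifBall d), ‖u‖ ≤ 1 := by
  refine Measure.ae_smul_measure ?_ _
  filter_upwards [ae_restrict_mem Metric.isClosed_closedBall.measurableSet] with u hu
  simpa using hu

theorem Continuous.integrable_unifBall {d : ℕ} {g : Euc d → ℝ} (hg : Continuous g) :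
    Integrable g (unifBall d) := by
  obtain ⟨C, hC⟩ := (isCompact_closedBall (0 : Euc d) 1).exists_bound_of_continuousOn
    hg.continuousOn
  refine Integrable.of_bound hg.aestronglyMeasurable C ?_
  filter_upwards [ae_unifBall_norm_le_one d] with u hu
  exact hC u (by simpa using hu)

theorem Continuous.integrable_shift_unifBall {d : ℕ} {f : Euc d → ℝ} (hf : Continuous f)
    (α : ℝ) (x : Euc d) : Integrable (fun u => f (x + α • u)) (unifBall d) :=
  (hf.comp (by fun_prop : Continuous fun u : Euc d => x + α • u)).integrable_unifBall

theorem integrable_and_hasFDerivAt_smoothed {d : ℕ} {f : Euc d → ℝ} (hd : Differentiable ℝ f)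
    (hl : LocallyLipschitz f) (α : ℝ) (x : Euc d) :
    Integrable (fun u => fderiv ℝ f (x + α • u)) (unifBall d) ∧
      HasFDerivAt (smoothed d f α) (∫ u, fderiv ℝ f (x + α • u) ∂(unifBall d)) x := by
  obtain ⟨K, hK⟩ := hl.locallyLipschitzOn.exists_lipschitzOnWith_of_compact
    (isCompact_closedBall x (1 + |α|))
  refine hasFDerivAt_integral_of_dominated_loc_of_lip (bound := fun _ => (K : ℝ))
    (F := fun x u => f (x + α • u)) (Metric.ball_mem_nhds x one_pos)
    (.of_forall fun y => (hd.continuous.integrable_shift_unifBall α y).aestronglyMeasurable)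
    (hd.continuous.integrable_shift_unifBall α x) ?_ ?_ (integrable_const _) ?_
  · exact ((measurable_fderiv ℝ f).comp
      (by fun_prop : Measurable fun u : Euc d => x + α • u)).aestronglyMeasurable
  · filter_upwards [ae_unifBall_norm_le_one d] with u hu
    have hmem : ∀ y ∈ Metric.ball x 1, y + α • u ∈ Metric.closedBall x (1 + |α|) := by
      intro y hy
      rw [Metric.mem_ball, dist_eq_norm] at hy
      rw [Metric.mem_closedBall, dist_eq_norm]
      calc ‖y + α • u - x‖ = ‖(y - x) + α • u‖ := by congr 1; abel
        _ ≤ ‖y - x‖ + ‖α • u‖ := norm_add_le _ _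
        _ ≤ 1 + |α| := by
          rw [norm_smul, Real.norm_eq_abs]
          exact add_le_add hy.le (mul_le_of_le_one_right (abs_nonneg α) hu)
    refine LipschitzOnWith.of_dist_le_mul fun y hy z hz => ?_
    simpa using hK.dist_le_mul _ (hmem y hy) _ (hmem z hz)
  · exact .of_forall fun u => by
      simpa using! (hd (x + α • u)).hasFDerivAt.comp x ((hasFDerivAt_id x).add_const (α • u))

theorem inner_gradient_eq_fderiv {E : Type*} [NormedAddCommGroup E] [InnerProductSpace ℝ E]
    [CompleteSpace E] (f : E → ℝ) (x v : E) : ⟪gradient f x, v⟫ = fderiv ℝ f x v := by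
  rw [← toDual_gradient, InnerProductSpace.toDual_apply_apply]

theorem norm_gradient_sub_eq_norm_fderiv_sub {E : Type*} [NormedAddCommGroup E]
    [InnerProductSpace ℝ E] [CompleteSpace E] (f : E → ℝ) (x y : E) :
    ‖gradient f x - gradient f y‖ = ‖fderiv ℝ f x - fderiv ℝ f y‖ := by
  rw [gradient, gradient, ← map_sub, LinearIsometryEquiv.norm_map]

theorem continuous_of_norm_sub_le_mul {E F : Type*} [SeminormedAddCommGroup E]
    [SeminormedAddCommGroup F] {g : E → F} {C : ℝ} (h : ∀ x y, ‖g x - g y‖ ≤ C * ‖x - y‖) :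
    Continuous g :=
  (LipschitzWith.of_dist_le' (K := C) fun x y => by
    simpa only [dist_eq_norm] using h x y).continuous

theorem convexOn_univ_of_le_linear {E : Type*} [AddCommGroup E] [Module ℝ E] {f : E → ℝ}
    (g : E → E →ₗ[ℝ] ℝ) (h : ∀ x y, f x + g x (y - x) ≤ f y) : ConvexOn ℝ Set.univ f := by
  refine ⟨convex_univ, fun x _ y _ a b ha hb hab => ?_⟩
  set z := a • x + b • y
  have hz : a * g z (x - z) + b * g z (y - z) = 0 := by
    rw [← smul_eq_mul, ← smul_eq_mul, ← map_smul, ← map_smul, ← map_add, smul_sub, smul_sub,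
      sub_add_sub_comm, ← add_smul, hab, one_smul, sub_self, map_zero]
  have hfz : f z = a * f z + b * f z := by rw [← add_mul, hab, one_mul]
  have hx := mul_le_mul_of_nonneg_left (h z x) ha
  have hy := mul_le_mul_of_nonneg_left (h z y) hb
  simp only [smul_eq_mul]
  linarith

/-- Properties inherited by the uniform-ball smoothing `f_α`:
(1) `L₀`-Lipschitz is preserved; (2) `L`-smoothness is preserved (and `f_α` is differentiable);
(3) `μ`-strong convexity (for differentiable `f`) is preserved. -/
theorem stmt_1 (d : ℕ) (hd : 1 ≤ d) (α : ℝ) (hα : 0 < α) (f : Euc d → ℝ) :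
    (∀ L₀ : ℝ, (∀ x y, |f x - f y| ≤ L₀ * ‖x - y‖) →
        ∀ x y, |smoothed d f α x - smoothed d f α y| ≤ L₀ * ‖x - y‖) ∧
    (∀ L : ℝ, Differentiable ℝ f →
        (∀ x y, ‖gradient f x - gradient f y‖ ≤ L * ‖x - y‖) →
        Differentiable ℝ (smoothed d f α) ∧
          ∀ x y, ‖gradient (smoothed d f α) x - gradient (smoothed d f α) y‖ ≤ L * ‖x - y‖) ∧
    (∀ μ : ℝ, 0 < μ → Differentiable ℝ f →
        (∀ x y, f x + ⟪gradient f x, y - x⟫ + μ / 2 * ‖y - x‖ ^ 2 ≤ f y) →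
        ∀ x y, smoothed d f α x + ⟪gradient (smoothed d f α) x, y - x⟫
            + μ / 2 * ‖y - x‖ ^ 2 ≤ smoothed d f α y) := by
  refine ⟨fun L₀ h x y => ?_, fun L hd h => ?_, fun μ hμ hd h x y => ?_⟩
  · have hc : Continuous f := continuous_of_norm_sub_le_mul h
    rw [smoothed, smoothed, ← integral_sub (hc.integrable_shift_unifBall α x)
      (hc.integrable_shift_unifBall α y)]
    simpa using norm_integral_le_of_norm_le_const (μ := unifBall d)
      (f := fun u => f (x + α • u) - f (y + α • u)) (C := L₀ * ‖x - y‖)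
      (.of_forall fun u => by simpa using h (x + α • u) (y + α • u))
  · simp only [norm_gradient_sub_eq_norm_fderiv_sub] at h ⊢
    have hl : LocallyLipschitz f :=
      (contDiff_one_iff_fderiv.2 ⟨hd, continuous_of_norm_sub_le_mul h⟩).locallyLipschitz
    have key := integrable_and_hasFDerivAt_smoothed hd hl α
    refine ⟨fun x => (key x).2.differentiableAt, fun x y => ?_⟩
    rw [(key x).2.fderiv, (key y).2.fderiv, ← integral_sub (key x).1 (key y).1]
    simpa using norm_integral_le_of_norm_le_const (μ := unifBall d)
      (f := fun u => fderiv ℝ f (x + α • u) - fderiv ℝ f (y + α • u)) (C := L * ‖x - y‖)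
      (.of_forall fun u => by simpa using h (x + α • u) (y + α • u))
  · simp only [inner_gradient_eq_fderiv] at h ⊢
    have hl : LocallyLipschitz f :=
      (convexOn_univ_of_le_linear (fun x => (fderiv ℝ f x : Euc d →ₗ[ℝ] ℝ)) fun x y =>
        (le_add_of_nonneg_right (by positivity)).trans (h x y)).locallyLipschitz
    obtain ⟨hint, hder⟩ := integrable_and_hasFDerivAt_smoothed hd hl α x
    have hfx := hd.continuous.integrable_shift_unifBall α x
    have hlin := hint.apply_continuousLinearMap (y - x)
    have hsum : Integrable (fun u => f (x + α • u) + fderiv ℝ f (x + α • u) (y - x))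
        (unifBall d) := hfx.add hlin
    have hconst : ∫ _, μ / 2 * ‖y - x‖ ^ 2 ∂(unifBall d) = μ / 2 * ‖y - x‖ ^ 2 := by simp
    rw [hder.fderiv, ContinuousLinearMap.integral_apply hint, ← hconst, smoothed, smoothed,
      ← integral_add hfx hlin, ← integral_add hsum (integrable_const _)]
    refine integral_mono (hsum.add (integrable_const _))
      (hd.continuous.integrable_shift_unifBall α y) fun u => ?_
    simpa using h (x + α • u) (y + α • u)
end
end

section
/- Let d ≥ 1, α > 0 and let f : ℝ^d → ℝ be L-smooth, and let f_α be the uniform-ball smoothed function. Then for every x ∈ ℝ^d: |f_α(x) − f(x)| ≤ L·α²/2 and ‖∇f_α(x) − ∇f(x)‖ ≤ L·α. Moreover, if f attains its minimum at a point x* and f_α attains its minimum at a point x̃*, then f(x*) ≤ f_α(x̃*) + L·α²/2. -/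
open MeasureTheory ProbabilityTheory
open scoped RealInnerProductSpace

noncomputable section

/-- Quadratic Taylor bound for a function with Lipschitz derivative. -/
theorem abs_sub_sub_fderiv_le {E : Type*} [NormedAddCommGroup E] [NormedSpace ℝ E]
    {f : E → ℝ} {L : ℝ} (hf : Differentiable ℝ f)
    (hL : ∀ x y, ‖fderiv ℝ f x - fderiv ℝ f y‖ ≤ L * ‖x - y‖) (x v : E) :
    |f (x + v) - f x - fderiv ℝ f x v| ≤ L * ‖v‖ ^ 2 / 2 := by
  have hg : ∀ t : ℝ, HasDerivAt (fun t : ℝ => f (x + t • v) - f x - t * fderiv ℝ f x v)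
      (fderiv ℝ f (x + t • v) v - fderiv ℝ f x v) t := by
    intro t
    have h1 : HasDerivAt (fun t : ℝ => x + t • v) v t := by
      simpa using ((hasDerivAt_id t).smul_const v).const_add x
    have h2 := (hf (x + t • v)).hasFDerivAt.comp_hasDerivAt t h1
    have h3 := (hasDerivAt_id t).mul_const (fderiv ℝ f x v)
    exact ((h2.sub_const (f x)).fun_sub h3).congr_deriv (by rw [one_mul])
  have hB : ∀ t : ℝ, HasDerivAt (fun t : ℝ => L * ‖v‖ ^ 2 / 2 * t ^ 2) (L * ‖v‖ ^ 2 * t) t := by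
    intro t
    exact ((hasDerivAt_pow 2 t).const_mul (L * ‖v‖ ^ 2 / 2)).congr_deriv (by push_cast; ring)
  have key := image_norm_le_of_norm_deriv_right_le_deriv_boundary (a := 0) (b := 1)
    (fun t _ => (hg t).continuousAt.continuousWithinAt)
    (fun t _ => (hg t).hasDerivWithinAt) (B := fun t : ℝ => L * ‖v‖ ^ 2 / 2 * t ^ 2)
    (by simp) hB (fun t ht => by
      rw [← sub_apply]
      calc ‖(fderiv ℝ f (x + t • v) - fderiv ℝ f x) v‖
          ≤ ‖fderiv ℝ f (x + t • v) - fderiv ℝ f x‖ * ‖v‖ := ContinuousLinearMap.le_opNorm _ _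
        _ ≤ L * ‖x + t • v - x‖ * ‖v‖ := by gcongr; exact hL _ _
        _ = L * ‖v‖ ^ 2 * t := by
          rw [add_sub_cancel_left, norm_smul, Real.norm_of_nonneg ht.1]; ring)
    (Set.right_mem_Icc.2 zero_le_one)
  simpa using key

/-- A function with Lipschitz derivative is continuously differentiable. -/
theorem continuous_fderiv_of_norm_sub_le {E : Type*} [NormedAddCommGroup E] [NormedSpace ℝ E]
    {f : E → ℝ} {L : ℝ}
    (hL : ∀ x y, ‖fderiv ℝ f x - fderiv ℝ f y‖ ≤ L * ‖x - y‖) : Continuous (fderiv ℝ f) :=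
  (LipschitzWith.of_dist_le' fun x y => by
    simpa only [dist_eq_norm] using hL x y).continuous

theorem isProbabilityMeasure_unifBall_s4 (d : ℕ) : IsProbabilityMeasure (unifBall d) := by
  constructor
  rw [unifBall, Measure.smul_apply, Measure.restrict_apply_univ, smul_eq_mul]
  exact ENNReal.inv_mul_cancel (Metric.measure_closedBall_pos _ _ one_pos).ne'
    measure_closedBall_lt_top.ne

theorem ae_norm_le_one_unifBall (d : ℕ) : ∀ᵐ u ∂unifBall d, ‖u‖ ≤ 1 := by
  refine Measure.ae_smul_measure ?_ _
  filter_upwards [ae_restrict_mem Metric.isClosed_closedBall.measurableSet] with u hu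
  simpa using hu

theorem integrable_unifBall_of_continuous {d : ℕ} {F : Type*} [NormedAddCommGroup F]
    {g : Euc d → F} (hg : Continuous g) : Integrable g (unifBall d) :=
  (hg.continuousOn.integrableOn_compact (isCompact_closedBall 0 1)).smul_measure
    (ENNReal.inv_ne_top.2 (Metric.measure_closedBall_pos _ _ one_pos).ne')

theorem integral_clm_unifBall (d : ℕ) (φ : Euc d →L[ℝ] ℝ) : ∫ u, φ u ∂unifBall d = 0 := by
  have h := (Measure.measurePreserving_neg (volume : Measure (Euc d))).setIntegral_preimage_emb
    (MeasurableEquiv.neg (Euc d)).measurableEmbedding φ (Metric.closedBall 0 1)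
  have hs : Neg.neg ⁻¹' Metric.closedBall (0 : Euc d) 1 = Metric.closedBall 0 1 := by
    ext u; simp
  rw [hs] at h
  simp only [map_neg, integral_neg] at h
  rw [unifBall, integral_smul_measure]
  rw [show ∫ u in Metric.closedBall (0 : Euc d) 1, φ u = 0 by linarith, smul_zero]

theorem abs_smoothed_sub_le {d : ℕ} {f : Euc d → ℝ} {L α : ℝ} (hL0 : 0 ≤ L)
    (hf : Differentiable ℝ f)
    (hL : ∀ x y, ‖fderiv ℝ f x - fderiv ℝ f y‖ ≤ L * ‖x - y‖) (x : Euc d) :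
    |smoothed d f α x - f x| ≤ L * α ^ 2 / 2 := by
  have := isProbabilityMeasure_unifBall_s4 d
  have hfc := hf.continuous
  have hi : Integrable (fun u => f (x + α • u)) (unifBall d) :=
    integrable_unifBall_of_continuous (by fun_prop)
  have hφ : Integrable (fun u => (α • fderiv ℝ f x) u) (unifBall d) :=
    integrable_unifBall_of_continuous (by fun_prop)
  have heq : smoothed d f α x - f x
      = ∫ u, (f (x + α • u) - f x - (α • fderiv ℝ f x) u) ∂unifBall d := by
    have hs : Integrable (fun u => f (x + α • u) - f x) (unifBall d) :=
      hi.sub (integrable_const _)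
    rw [integral_sub hs hφ, integral_clm_unifBall, sub_zero,
      integral_sub hi (integrable_const _), integral_const, probReal_univ, one_smul, smoothed]
  rw [heq, ← Real.norm_eq_abs]
  refine (norm_integral_le_of_norm_le_const (C := L * α ^ 2 / 2) ?_).trans (by simp)
  filter_upwards [ae_norm_le_one_unifBall d] with u hu
  have h := abs_sub_sub_fderiv_le hf hL x (α • u)
  rw [map_smul] at h
  refine h.trans ?_
  rw [norm_smul, mul_pow, Real.norm_eq_abs, sq_abs]
  have : ‖u‖ ^ 2 ≤ 1 := pow_le_one₀ (norm_nonneg u) hu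
  gcongr
  exact mul_le_of_le_one_right (sq_nonneg α) this

theorem hasFDerivAt_smoothed {d : ℕ} {f : Euc d → ℝ} {L α : ℝ} (hL0 : 0 ≤ L) (hα : 0 ≤ α)
    (hf : Differentiable ℝ f)
    (hL : ∀ x y, ‖fderiv ℝ f x - fderiv ℝ f y‖ ≤ L * ‖x - y‖) (x : Euc d) :
    HasFDerivAt (smoothed d f α) (∫ u, fderiv ℝ f (x + α • u) ∂unifBall d) x := by
  have := isProbabilityMeasure_unifBall_s4 d
  have hfc := hf.continuous
  have hf' := continuous_fderiv_of_norm_sub_le hL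
  refine hasFDerivAt_integral_of_dominated_of_fderiv_le
    (F := fun y u => f (y + α • u)) (F' := fun y u => fderiv ℝ f (y + α • u))
    (bound := fun _ => L * (1 + α) + ‖fderiv ℝ f x‖) (Metric.ball_mem_nhds x one_pos)
    (Filter.Eventually.of_forall fun y => ?_) ?_ ?_ ?_ (integrable_const _) ?_
  · exact Continuous.aestronglyMeasurable (by fun_prop)
  · exact integrable_unifBall_of_continuous (by fun_prop)
  · exact Continuous.aestronglyMeasurable (by fun_prop)
  · filter_upwards [ae_norm_le_one_unifBall d] with u hu y hy
    have hy' : ‖y + α • u - x‖ ≤ 1 + α := by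
      rw [add_sub_right_comm]
      refine (norm_add_le _ _).trans (add_le_add (mem_ball_iff_norm.1 hy).le ?_)
      rw [norm_smul, Real.norm_of_nonneg hα]
      exact mul_le_of_le_one_right hα hu
    calc ‖fderiv ℝ f (y + α • u)‖
        ≤ ‖fderiv ℝ f (y + α • u) - fderiv ℝ f x‖ + ‖fderiv ℝ f x‖ := norm_le_norm_sub_add _ _
      _ ≤ L * (1 + α) + ‖fderiv ℝ f x‖ := by
        gcongr
        exact (hL _ _).trans (by gcongr)
  · exact Filter.Eventually.of_forall fun u y _ =>
      (hasFDerivAt_comp_add_right (α • u)).2 (hf (y + α • u)).hasFDerivAt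

theorem norm_fderiv_smoothed_sub_le {d : ℕ} {f : Euc d → ℝ} {L α : ℝ} (hL0 : 0 ≤ L)
    (hα : 0 ≤ α) (hf : Differentiable ℝ f)
    (hL : ∀ x y, ‖fderiv ℝ f x - fderiv ℝ f y‖ ≤ L * ‖x - y‖) (x : Euc d) :
    ‖fderiv ℝ (smoothed d f α) x - fderiv ℝ f x‖ ≤ L * α := by
  have := isProbabilityMeasure_unifBall_s4 d
  have hf' := continuous_fderiv_of_norm_sub_le hL
  have heq : fderiv ℝ (smoothed d f α) x - fderiv ℝ f x
      = ∫ u, (fderiv ℝ f (x + α • u) - fderiv ℝ f x) ∂unifBall d := by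
    rw [(hasFDerivAt_smoothed hL0 hα hf hL x).fderiv,
      integral_sub (integrable_unifBall_of_continuous (by fun_prop)) (integrable_const _),
      integral_const, probReal_univ, one_smul]
  rw [heq]
  refine (norm_integral_le_of_norm_le_const (C := L * α) ?_).trans (by simp)
  filter_upwards [ae_norm_le_one_unifBall d] with u hu
  refine (hL _ _).trans ?_
  rw [add_sub_cancel_left, norm_smul, Real.norm_of_nonneg hα]
  gcongr
  exact mul_le_of_le_one_right hα hu

theorem norm_gradient_sub_gradient {E : Type*} [NormedAddCommGroup E] [InnerProductSpace ℝ E]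
    [CompleteSpace E] (f g : E → ℝ) (x y : E) :
    ‖gradient f x - gradient g y‖ = ‖fderiv ℝ f x - fderiv ℝ g y‖ := by
  rw [gradient, gradient, ← map_sub, LinearIsometryEquiv.norm_map]

/-- For `L`-smooth `f`: `|f_α(x) − f(x)| ≤ L·α²/2`, `‖∇f_α(x) − ∇f(x)‖ ≤ L·α`, and if `f`
attains its minimum at `x*` and `f_α` at `x̃*`, then `f(x*) ≤ f_α(x̃*) + L·α²/2`. -/
theorem stmt_4 (d : ℕ) (hd : 1 ≤ d) (α : ℝ) (hα : 0 < α) (L : ℝ)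
    (f : Euc d → ℝ) (hdiff : Differentiable ℝ f)
    (hsmooth : ∀ x y, ‖gradient f x - gradient f y‖ ≤ L * ‖x - y‖) :
    (∀ x, |smoothed d f α x - f x| ≤ L * α ^ 2 / 2) ∧
    (∀ x, ‖gradient (smoothed d f α) x - gradient f x‖ ≤ L * α) ∧
    (∀ xstar xtil : Euc d, IsMinOn f Set.univ xstar →
        IsMinOn (smoothed d f α) Set.univ xtil →
        f xstar ≤ smoothed d f α xtil + L * α ^ 2 / 2) := by
  have hL : ∀ x y, ‖fderiv ℝ f x - fderiv ℝ f y‖ ≤ L * ‖x - y‖ := fun x y => by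
    rw [← norm_gradient_sub_gradient]
    exact hsmooth x y
  have hL0 : 0 ≤ L := by
    have h := (norm_nonneg _).trans (hsmooth (EuclideanSpace.single ⟨0, hd⟩ 1) 0)
    simpa using h
  have hval : ∀ x, |smoothed d f α x - f x| ≤ L * α ^ 2 / 2 :=
    abs_smoothed_sub_le hL0 hdiff hL
  refine ⟨hval, fun x => ?_, fun xstar xtil hstar _ => ?_⟩
  · rw [norm_gradient_sub_gradient]
    exact norm_fderiv_smoothed_sub_le hL0 hα.le hdiff hL x
  · have hmin : f xstar ≤ f xtil := hstar (Set.mem_univ xtil)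
    have hlow := (abs_le.1 (hval xtil)).1
    linarith
end
end
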